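/- arXiv:1105.0142 — 2 statements merged into one kernel-verified Lean document; each statement's English description precedes it below -/
import Mathlib

section
/- Let D ⊆ A ⊆ B be extensions of integral domains (injective ring homomorphisms), with quotient fields K of D, L of A, and M of B, so that K embeds in L and L in M. If A is a weakly polynomially complete extension of D (Int(D) ⊆ Int(A), comparing inside M[X]) and B is a polynomially regular extension of D, then B is a polynomially regular extension of A, i.e., Int(A,B) = B·Int(A). -/
namespace IVP

open Polynomial

variable {F : Type} [Field F]

/-- Integer-valued polynomials on the set `E` with values in `D`:
`Int(E,D) = {f ∈ F[X] : f(E) ⊆ D}`. -/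
def IntOn (E D : Set F) : Set (Polynomial F) := {f | ∀ x ∈ E, f.eval x ∈ D}

/-- `Int(D) = {f ∈ F[X] : f(D) ⊆ D}`. -/
def IntR (D : Set F) : Set (Polynomial F) := IntOn D D

/-- Polynomials with all coefficients in `R`, i.e. `R[X]` as a subset of `F[X]`. -/
def polySet (R : Set F) : Set (Polynomial F) := {f | ∀ n, f.coeff n ∈ R}

/-- `I⁻¹ = (D :_K I) = {x : x·I ⊆ D}`. -/
def dinv (D I : Set F) : Set F := {x | ∀ y ∈ I, x * y ∈ D}

/-- `I_v = (I⁻¹)⁻¹`. -/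
def dv (D I : Set F) : Set F := dinv D (dinv D I)

/-- `I_t = ⋃ J_v`, the union over all nonzero finitely generated fractional ideals
`J ⊆ I`; such a `J` is the `D`-span of a finite set `T ⊆ I` containing a nonzero
element, and `J_v` depends only on `T`. -/
def dt (D I : Set F) : Set F :=
  {x | ∃ T : Finset F, ↑T ⊆ I ∧ (∃ y ∈ T, y ≠ 0) ∧ x ∈ dv D ↑T}

/-- The image in `F` of a set of elements of the subring `D`. -/
def iset (D : Subring F) (I : Set ↥D) : Set F := (↑) '' I

/-- `I` is a t-ideal: `I_t = I`. -/
def IsTIdeal (D I : Set F) : Prop := dt D I = I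

/-- `I` is a v-ideal: `I_v = I`. -/
def IsVIdeal (D I : Set F) : Prop := dv D I = I

/-- `p` is a t-maximal ideal of `D`: maximal among the t-ideals properly contained
in `D`. -/
def IsTMax (D : Subring F) (p : Ideal ↥D) : Prop :=
  p ≠ ⊤ ∧ IsTIdeal ↑D (iset D ↑p) ∧
    ∀ q : Ideal ↥D, q ≠ ⊤ → IsTIdeal ↑D (iset D ↑q) → p ≤ q → p = q

/-- `p` is a v-maximal ideal of `D`: maximal among the v-ideals properly contained
in `D`. -/
def IsVMax (D : Subring F) (p : Ideal ↥D) : Prop :=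
  p ≠ ⊤ ∧ IsVIdeal ↑D (iset D ↑p) ∧
    ∀ q : Ideal ↥D, q ≠ ⊤ → IsVIdeal ↑D (iset D ↑q) → p ≤ q → p = q

/-- The localization `S⁻¹D` of `D` at a multiplicative subset `S ⊆ D`, as a subset
of `F`. -/
def mlocSet (D : Subring F) (S : Set ↥D) : Set F :=
  {x | ∃ a : ↥D, ∃ s ∈ S, (s : F) * x = (a : F)}

/-- The localization `D_p` of `D` at the complement of `p`, as a subset of `F`. -/
def plocSet (D : Subring F) (p : Ideal ↥D) : Set F := mlocSet D {s | s ∉ p}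

/-- The localization `S⁻¹R` of a set `R` of polynomials at a multiplicative subset
`S ⊆ D`, as a subset of `F[X]`. -/
def mlocPoly (D : Subring F) (S : Set ↥D) (R : Set (Polynomial F)) : Set (Polynomial F) :=
  {f | ∃ g ∈ R, ∃ s ∈ S, C (s : F) * f = g}

/-- The localization `R_p` of a set `R` of polynomials at `D ∖ p`. -/
def plocPoly (D : Subring F) (p : Ideal ↥D) (R : Set (Polynomial F)) : Set (Polynomial F) :=
  mlocPoly D {s | s ∉ p} R

/-- The ideal `pD_p` of the localization `D_p`, as a subset of `F`. -/
def plocIdl (D : Subring F) (p : Ideal ↥D) : Set F :=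
  {x | ∃ y ∈ p, ∃ s : ↥D, s ∉ p ∧ (s : F) * x = ((y : ↥D) : F)}

/-- `p` is t-localizing: `pD_p` is a t-ideal of `D_p`. -/
def TLocalizing (D : Subring F) (p : Ideal ↥D) : Prop :=
  IsTIdeal (plocSet D p) (plocIdl D p)

/-- `F` is the quotient field of `D`. -/
def IsQuotField (D : Subring F) : Prop :=
  ∀ x : F, ∃ a b : ↥D, b ≠ 0 ∧ (b : F) * x = (a : F)

/-- The quotient field of `D`, as a subset of the ambient field. -/
def fracSet (D : Subring F) : Set F :=
  {x | ∃ a b : ↥D, b ≠ 0 ∧ (b : F) * x = (a : F)}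

/-- The conductor ideal `(aD :_D bD) = {d ∈ D : d·b ∈ aD}` of `D`. -/
def Conductor (D : Subring F) (a b : ↥D) : Set ↥D := {d | ∃ c : ↥D, d * b = a * c}

/-- Elementwise product of two subsets of `F`. -/
def setMul (A B : Set F) : Set F := {z | ∃ x ∈ A, ∃ y ∈ B, z = x * y}

/-- The ideal `I` of `D` is t-invertible: `(I⁻¹I)_t = D`. -/
def TInv (D : Subring F) (I : Ideal ↥D) : Prop :=
  dt ↑D (setMul (dinv ↑D (iset D ↑I)) (iset D ↑I)) = (↑D : Set F)

/-- The ideal `I` of `D` is v-invertible: `(I⁻¹I)_v = D`. -/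
def VInv (D : Subring F) (I : Ideal ↥D) : Prop :=
  dv ↑D (setMul (dinv ↑D (iset D ↑I)) (iset D ↑I)) = (↑D : Set F)

/-- `D` is a PVMD: every nonzero finitely generated ideal of `D` is t-invertible. -/
def IsPVMD (D : Subring F) : Prop :=
  ∀ I : Ideal ↥D, I ≠ ⊥ → I.FG → TInv D I

/-- `D` is an H domain: every v-invertible nonzero ideal of `D` is t-invertible. -/
def IsHDomain (D : Subring F) : Prop :=
  ∀ I : Ideal ↥D, I ≠ ⊥ → VInv D I → TInv D I

/-- `p ∈ sKr(K/D)`: `p` is a prime such that every finitely generated ideal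
`I ⊆ p` satisfies `I ⊆ J ⊆ p` for some conductor ideal `J` of `D`. -/
def SKrMem (D : Subring F) (p : Ideal ↥D) : Prop :=
  p.IsPrime ∧ ∀ I : Ideal ↥D, I.FG → I ≤ p →
    ∃ a b : ↥D, a ≠ 0 ∧ (↑I : Set ↥D) ⊆ Conductor D a b ∧ Conductor D a b ⊆ ↑p

/-- The localization `A_p` of `A ⊇ D` at the complement in `D` of a prime `p` of `D`,
as a subset of the ambient field. -/
def mixedLocSet (D A : Subring F) (p : Ideal ↥D) : Set F :=
  {x | ∃ a : ↥A, ∃ s : ↥D, s ∉ p ∧ (s : F) * x = (a : F)}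

/-- `pD_p` is a principal ideal of `D_p`. -/
def PLocPrincipal (D : Subring F) (p : Ideal ↥D) : Prop :=
  ∃ g : F, plocIdl D p = {x | ∃ d ∈ plocSet D p, x = d * g}

/-- The localization `A_p` of `A ⊇ D` at a prime `p` of `D`, as a subring of the
ambient field. -/
def mixedLoc (D A : Subring F) (hDA : D ≤ A) (p : Ideal ↥D) (hp : p.IsPrime) :
    Subring F where
  carrier := mixedLocSet D A p
  one_mem' := ⟨1, 1, fun h => hp.ne_top (Ideal.eq_top_of_isUnit_mem p h isUnit_one), by simp⟩
  zero_mem' := ⟨0, 1, fun h => hp.ne_top (Ideal.eq_top_of_isUnit_mem p h isUnit_one), by simp⟩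
  mul_mem' := by
    rintro x y ⟨a, s, hs, hx⟩ ⟨b, t, ht, hy⟩
    refine ⟨a * b, s * t, fun h => ((hp.mem_or_mem h).elim hs ht), ?_⟩
    push_cast
    rw [mul_mul_mul_comm, hx, hy]
  add_mem' := by
    rintro x y ⟨a, s, hs, hx⟩ ⟨b, t, ht, hy⟩
    refine ⟨⟨t, hDA t.2⟩ * a + ⟨s, hDA s.2⟩ * b, s * t,
      fun h => ((hp.mem_or_mem h).elim hs ht), ?_⟩
    push_cast
    rw [mul_add]
    rw [show ((s:F) * t) * x = (t:F) * ((s:F) * x) by ring, hx,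
      show ((s:F) * t) * y = (s:F) * ((t:F) * y) by ring, hy]
  neg_mem' := by
    rintro x ⟨a, s, hs, hx⟩
    exact ⟨-a, s, hs, by push_cast; rw [mul_neg, hx]⟩

/-- The localization `D_p` of `D` at a prime `p`, as a subring of `F`. -/
def primeLoc (D : Subring F) (p : Ideal ↥D) (hp : p.IsPrime) : Subring F :=
  mixedLoc D D le_rfl p hp

/-- `Int(D)` as a subring of `F[X]`. -/
def IntSubring (D : Subring F) : Subring (Polynomial F) where
  carrier := IntR ↑D
  one_mem' := fun x _ => by simpa using D.one_mem
  zero_mem' := fun x _ => by simpa using D.zero_mem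
  mul_mem' := fun hf hg x hx => by
    rw [eval_mul]; exact D.mul_mem (hf x hx) (hg x hx)
  add_mem' := fun hf hg x hx => by
    rw [eval_add]; exact D.add_mem (hf x hx) (hg x hx)
  neg_mem' := fun hf x hx => by
    rw [eval_neg]; exact D.neg_mem (hf x hx)

/-- `Int(D)` as a `D`-submodule of `F[X]`. -/
def intSubmodule (D : Subring F) : Submodule ↥D (Polynomial F) where
  carrier := IntR ↑D
  zero_mem' := fun x _ => by simpa using D.zero_mem
  add_mem' := fun hf hg x hx => by
    rw [eval_add]; exact D.add_mem (hf x hx) (hg x hx)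
  smul_mem' := fun c f hf x hx => by
    have h : c • f = C (c : F) * f := by
      rw [Algebra.smul_def]; rfl
    rw [h, eval_mul, eval_C]
    exact D.mul_mem c.2 (hf x hx)

/-- An overring `D'` of `D` as a `D`-submodule of `F`. -/
def subringSubmodule (D D' : Subring F) (h : D ≤ D') : Submodule ↥D F where
  carrier := ↑D'
  zero_mem' := D'.zero_mem
  add_mem' := fun ha hb => D'.add_mem ha hb
  smul_mem' := fun c x hx => by
    rw [Subring.smul_def]
    exact D'.mul_mem (h c.2) hx

/-- `Int(D)_p` as a `D_p`-submodule of `F[X]`. -/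
def plocIntSubmodule (D : Subring F) (p : Ideal ↥D) (hp : p.IsPrime) :
    Submodule ↥(primeLoc D p hp) (Polynomial F) where
  carrier := plocPoly D p (IntR ↑D)
  zero_mem' :=
    ⟨0, fun x _ => by simpa using D.zero_mem, 1,
      fun h => hp.ne_top (Ideal.eq_top_of_isUnit_mem p h isUnit_one), by simp⟩
  add_mem' := by
    rintro f f' ⟨g, hg, s, hs, hfg⟩ ⟨g', hg', t, ht, hfg'⟩
    refine ⟨C (t : F) * g + C (s : F) * g', ?_, s * t,
      fun h => ((hp.mem_or_mem h).elim hs ht), ?_⟩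
    · intro x hx
      rw [eval_add, eval_mul, eval_mul, eval_C, eval_C]
      exact D.add_mem (D.mul_mem t.2 (hg x hx)) (D.mul_mem s.2 (hg' x hx))
    · rw [← hfg, ← hfg']
      push_cast
      rw [map_mul]
      ring
  smul_mem' := by
    rintro c f ⟨g, hg, t, ht, hfg⟩
    obtain ⟨a, s, hs, hsc⟩ := c.2
    have h : c • f = C (c : F) * f := by rw [Algebra.smul_def]; rfl
    refine ⟨C (a : F) * g, ?_, s * t,
      fun hmem => ((hp.mem_or_mem hmem).elim hs ht), ?_⟩
    · intro x hx
      rw [eval_mul, eval_C]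
      exact D.mul_mem a.2 (hg x hx)
    · rw [h, ← hfg, ← hsc]
      push_cast
      rw [map_mul, map_mul]
      ring

section Extensions

variable {L : Type} [Field L]

/-- The data of an extension: the subring `A` of `L` contains the image of `D`
under the embedding `φ` of quotient fields. -/
def ExtMem (D : Subring F) (φ : F →+* L) (A : Subring L) : Prop := ∀ d : ↥D, φ d ∈ A

/-- The injective ring homomorphism `D → A` induced by `φ`. -/
noncomputable def extHom (D : Subring F) (φ : F →+* L) (A : Subring L)
    (h : ExtMem D φ A) : ↥D →+* ↥A :=
  (φ.comp D.subtype).codRestrict A.toSubsemiring (fun d => h d)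

/-- The extension `A ⊇ D` is polynomially regular: `Int(D,A) = A·Int(D)`. -/
def PolyReg (D : Subring F) (φ : F →+* L) (A : Subring L) : Prop :=
  IntOn (φ '' ↑D) ↑A = ↑(Submodule.span ↥A (Polynomial.map φ '' IntR (↑D : Set F)))

/-- The extension `A ⊇ D` is weakly polynomially complete: `Int(D) ⊆ Int(A)`. -/
def WPolyComplete (D : Subring F) (φ : F →+* L) (A : Subring L) : Prop :=
  Polynomial.map φ '' IntR (↑D : Set F) ⊆ IntR (↑A : Set L)

/-- The extension `A ⊇ D` is polynomially complete: `Int(D,A) = Int(A)`. -/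
def PolyComplete (D : Subring F) (φ : F →+* L) (A : Subring L) : Prop :=
  IntOn (φ '' ↑D) ↑A = IntR (↑A : Set L)

/-- The extension `A ⊇ D` is flat: `A` is flat as a `D`-module. -/
def ExtFlat (D : Subring F) (φ : F →+* L) (A : Subring L) (h : ExtMem D φ A) : Prop :=
  letI : Module ↥D ↥A := Module.compHom ↥A (extHom D φ A h)
  Module.Flat ↥D ↥A

/-- The extension `A ⊇ D` is t-linked: `I_t = D` implies `(IA)_t = A` for every
nonzero ideal `I` of `D`. -/
def TLinkedExt (D : Subring F) (φ : F →+* L) (A : Subring L) (h : ExtMem D φ A) : Prop :=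
  ∀ I : Ideal ↥D, I ≠ ⊥ → dt ↑D (iset D ↑I) = (↑D : Set F) →
    dt ↑A (iset A ↑(Ideal.map (extHom D φ A h) I)) = (↑A : Set L)

/-- `D` is absolutely polynomially regular: every extension of `D` is polynomially
regular. -/
def AbsPolyReg (D : Subring F) : Prop :=
  ∀ (L : Type) [Field L], ∀ (φ : F →+* L) (A : Subring L),
    ExtMem D φ A → IsQuotField A → PolyReg D φ A

/-- `D` is polynomially F-regular: every flat extension of `D` is polynomially
regular. -/
def PFReg (D : Subring F) : Prop :=
  ∀ (L : Type) [Field L], ∀ (φ : F →+* L) (A : Subring L) (h : ExtMem D φ A),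
    IsQuotField A → ExtFlat D φ A h → PolyReg D φ A

/-- `D` is polynomially t-regular: every t-linked extension of `D` is polynomially
regular. -/
def PTReg (D : Subring F) : Prop :=
  ∀ (L : Type) [Field L], ∀ (φ : F →+* L) (A : Subring L) (h : ExtMem D φ A),
    IsQuotField A → TLinkedExt D φ A h → PolyReg D φ A

/-- `D` is polynomially L-regular: `Int(S⁻¹D) = S⁻¹Int(D)` for every multiplicative
subset `S` of `D` with `0 ∉ S`. -/
def PLReg (D : Subring F) : Prop :=
  ∀ S : Submonoid ↥D, (0 : ↥D) ∉ S →
    IntR (mlocSet D ↑S) = mlocPoly D ↑S (IntR (↑D : Set F))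

end Extensions

/-- The extension of an ideal `I` of `R` to an overring `S` of `R` inside a common
field: the ideal `IS` of `S` generated by `I`. -/
def extIdeal (R S : Subring F) (I : Ideal ↥R) : Ideal ↥S :=
  Ideal.span {y : ↥S | (y : F) ∈ iset R ↑I}

/-- Within a common field: `S` is a t-linked extension of `R`. -/
def TLinkedSub (R S : Subring F) : Prop :=
  R ≤ S ∧ ∀ I : Ideal ↥R, I ≠ ⊥ → dt ↑R (iset R ↑I) = (↑R : Set F) →
    dt ↑S (iset S ↑(extIdeal R S I)) = (↑S : Set F)

/-- Localization of a subset `R` of the ambient field at `D ∖ q`. -/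
def locOfSet (D : Subring F) (R : Set F) (q : Ideal ↥D) : Set F :=
  {x | ∃ y ∈ R, ∃ s : ↥D, s ∉ q ∧ (s : F) * x = y}

end IVP

open IVP Polynomial

/-- If `D ⊆ A ⊆ B` are extensions of domains, `A` is a weakly
polynomially complete extension of `D`, and `B` is a polynomially regular extension
of `D`, then `B` is a polynomially regular extension of `A`. -/
theorem stmt_18 (F : Type) [Field F] (L : Type) [Field L] (M : Type) [Field M]
    (D : Subring F) (φ : F →+* L) (A : Subring L) (ψ : L →+* M) (B : Subring M)
    (hA : ExtMem D φ A) (hB : ExtMem A ψ B)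
    (hqfD : IsQuotField D) (hqfA : IsQuotField A) (hqfB : IsQuotField B)
    (hwpc : Polynomial.map (ψ.comp φ) '' IntR (↑D : Set F) ⊆
      Polynomial.map ψ '' IntR (↑A : Set L))
    (hreg : PolyReg D (ψ.comp φ) B) :
    PolyReg A ψ B := by
  refine Set.Subset.antisymm (fun f hf => ?_) (fun f hf => ?_)
  · have hfD : f ∈ IntOn ((ψ.comp φ) '' (D : Set F)) (B : Set M) := by
      rintro _ ⟨d, hd, rfl⟩
      exact hf _ ⟨φ d, hA ⟨d, hd⟩, rfl⟩
    rw [hreg] at hfD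
    exact Submodule.span_mono hwpc hfD
  · induction hf using Submodule.span_induction with
    | mem g hg =>
      obtain ⟨g, hg, rfl⟩ := hg
      rintro _ ⟨a, ha, rfl⟩
      rw [eval_map_apply]
      exact hB ⟨_, hg a ha⟩
    | zero => exact fun x _ => by simp
    | add g h _ _ hg hh =>
      intro x hx
      rw [eval_add]
      exact B.add_mem (hg x hx) (hh x hx)
    | smul b g _ hg =>
      intro x hx
      rw [eval_smul, Subring.smul_def]
      exact B.mul_mem b.2 (hg x hx)
end

section
/- Let D be an integral domain with quotient field K ≠ D such that every t-maximal ideal p of D with D/p finite satisfies: pD_p is a principal ideal of D_p and Int(D_p) = Int(D)_p. Let A be a t-linked extension of D. Then the following are equivalent: (1) A is a polynomially complete extension of D, i.e., Int(D,A) = Int(A); (2) A is a weakly polynomially complete extension of D, i.e., Int(D) ⊆ Int(A); (3) for every t-maximal ideal p of D with D/p finite and every prime ideal q of A lying over p, one has pA_q = qA_q and the induced embedding of residue fields κ(p) = D_p/pD_p → κ(q) = A_q/qA_q is an isomorphism. -/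
open IVP Polynomial

namespace IVP

section TClosure

variable {F : Type} [Field F]

theorem mem_iset_iff {D : Subring F} {I : Ideal ↥D} {x : F} :
    x ∈ iset D ↑I ↔ ∃ h : x ∈ D, (⟨x, h⟩ : ↥D) ∈ I := by
  constructor
  · rintro ⟨y, hy, rfl⟩
    exact ⟨y.2, hy⟩
  · rintro ⟨h, hx⟩
    exact ⟨_, hx, rfl⟩

theorem one_mem_dt_iff {D I : Set F} :
    1 ∈ dt D I ↔ ∃ T : Finset F, ↑T ⊆ I ∧ (∃ y ∈ T, y ≠ 0) ∧
      ∀ y, (∀ t ∈ T, y * t ∈ D) → y ∈ D := by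
  simp [dt, dv, dinv]

theorem dt_mono {D I J : Set F} (h : I ⊆ J) : dt D I ⊆ dt D J := by
  rintro x ⟨T, hT, hne, hx⟩
  exact ⟨T, hT.trans h, hne, hx⟩

theorem iset_mono {D : Subring F} {I J : Ideal ↥D} (h : I ≤ J) :
    iset D ↑I ⊆ iset D ↑J :=
  Set.image_mono h

theorem dt_subset {D : Subring F} (I : Ideal ↥D) : dt ↑D (iset D ↑I) ⊆ ↑D := by
  rintro x ⟨T, hT, -, hx⟩
  have h := hx 1 (fun t ht => by
    rw [one_mul]
    exact (mem_iset_iff.1 (hT ht)).1)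
  rwa [mul_one] at h

theorem dt_eq_of_one_mem {D : Subring F} {I : Ideal ↥D} (h : 1 ∈ dt ↑D (iset D ↑I)) :
    dt ↑D (iset D ↑I) = ↑D := by
  refine (dt_subset I).antisymm fun d hd => ?_
  obtain ⟨T, hT, hne, hy⟩ := one_mem_dt_iff.1 h
  exact ⟨T, hT, hne, fun y hyT => D.mul_mem hd (hy y hyT)⟩

/-- The maximal elements among the ideals `I` with `1 ∉ I_t` are prime. -/
theorem isPrime_of_maximal {D : Subring F} {q : Ideal ↥D}
    (hq : Maximal (· ∈ {I : Ideal ↥D | (1 : F) ∉ dt ↑D (iset D ↑I)}) q) : q.IsPrime := by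
  have hext : ∀ a ∉ q, (1 : F) ∈ dt ↑D (iset D ↑(q ⊔ Ideal.span {a})) := by
    intro a ha
    by_contra h
    exact ha (hq.2 h le_sup_left (Ideal.mem_sup_right (Ideal.mem_span_singleton_self a)))
  refine ⟨?_, ?_⟩
  · rintro rfl
    refine hq.1 (one_mem_dt_iff.2 ⟨{1}, ?_, ⟨1, by simp⟩, fun y hy => by simpa using hy⟩)
    simp only [Finset.coe_singleton, Set.singleton_subset_iff]
    exact mem_iset_iff.2 ⟨D.one_mem, trivial⟩
  · intro a b hab
    by_contra! h
    obtain ⟨T₁, h₁, ⟨y₁, hy₁, hy₁'⟩, hd₁⟩ := one_mem_dt_iff.1 (hext a h.1)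
    obtain ⟨T₂, h₂, ⟨y₂, hy₂, hy₂'⟩, hd₂⟩ := one_mem_dt_iff.1 (hext b h.2)
    classical
    refine hq.1 (one_mem_dt_iff.2 ⟨Finset.image₂ (· * ·) T₁ T₂, ?_,
      ⟨y₁ * y₂, Finset.mem_image₂_of_mem hy₁ hy₂, mul_ne_zero hy₁' hy₂'⟩, fun y hy => ?_⟩)
    · intro z hz
      obtain ⟨t₁, ht₁, t₂, ht₂, rfl⟩ := Finset.mem_image₂.1 hz
      obtain ⟨k₁, m₁⟩ := mem_iset_iff.1 (h₁ ht₁)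
      obtain ⟨k₂, m₂⟩ := mem_iset_iff.1 (h₂ ht₂)
      refine mem_iset_iff.2 ⟨D.mul_mem k₁ k₂, ?_⟩
      have hm : (⟨t₁, k₁⟩ * ⟨t₂, k₂⟩ : ↥D) ∈
          (q ⊔ Ideal.span {a}) * (q ⊔ Ideal.span {b}) := Ideal.mul_mem_mul m₁ m₂
      have hle : (q ⊔ Ideal.span {a}) * (q ⊔ Ideal.span {b}) ≤ q := by
        rw [Ideal.sup_mul, Ideal.mul_sup (Ideal.span {a}), Ideal.span_singleton_mul_span_singleton]
        refine sup_le Ideal.mul_le_left (sup_le Ideal.mul_le_right ?_)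
        rwa [Ideal.span_singleton_le_iff_mem]
      exact hle hm
    · refine hd₁ y fun t₁ ht₁ => hd₂ _ fun t₂ ht₂ => ?_
      rw [mul_assoc]
      exact hy _ (Finset.mem_image₂_of_mem ht₁ ht₂)

theorem exists_maximal_ge {D : Subring F} (I : Ideal ↥D)
    (hI : (1 : F) ∉ dt ↑D (iset D ↑I)) :
    ∃ q, I ≤ q ∧ Maximal (· ∈ {I : Ideal ↥D | (1 : F) ∉ dt ↑D (iset D ↑I)}) q := by
  refine zorn_le_nonempty₀ {I : Ideal ↥D | (1 : F) ∉ dt (↑D : Set F) (iset D ↑I)}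
    (fun c hc hch y hy => ⟨sSup c, ?_, fun z hz => le_sSup hz⟩) I hI
  intro h1
  obtain ⟨T, hT, hne, hd⟩ := one_mem_dt_iff.1 h1
  have hcov : (↑T : Set F) ⊆ ⋃ i ∈ c, iset D (↑i : Set ↥D) := by
    intro x hx
    obtain ⟨hxD, hxs⟩ := mem_iset_iff.1 (hT hx)
    obtain ⟨J, hJ, hxJ⟩ := (Submodule.mem_sSup_of_directed ⟨y, hy⟩ hch.directedOn).1 hxs
    exact Set.mem_biUnion hJ (mem_iset_iff.2 ⟨hxD, hxJ⟩)
  obtain ⟨J, hJ, hTJ⟩ := DirectedOn.exists_mem_subset_of_finset_subset_biUnion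
    (f := fun i : Ideal ↥D => iset D (↑i : Set ↥D)) ⟨y, hy⟩
    (fun a ha b hb => (hch.directedOn a ha b hb).imp fun _ h =>
      ⟨h.1, iset_mono h.2.1, iset_mono h.2.2⟩) hcov
  exact hc hJ (one_mem_dt_iff.2 ⟨T, hTJ, hne, hd⟩)

/-- A maximal ideal `p ≠ 0` with `1 ∉ p_t` is t-maximal. -/
theorem isTMax_of_isMaximal {D : Subring F} {p : Ideal ↥D} (hp : p.IsMaximal) (h0 : p ≠ ⊥)
    (h1 : (1 : F) ∉ dt ↑D (iset D ↑p)) : IsTMax D p := by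
  refine ⟨hp.ne_top, ?_, fun q hq _ hle => hp.eq_of_le hq hle⟩
  refine Set.Subset.antisymm (fun x hx => ?_) (fun x hx => ?_)
  · have hxD := dt_subset p hx
    refine mem_iset_iff.2 ⟨hxD, ?_⟩
    by_contra hxp
    obtain ⟨T, hT, ⟨y, hy, hy0⟩, hv⟩ := hx
    obtain ⟨d, m, hm, hdm⟩ := hp.exists_inv hxp
    classical
    refine h1 (one_mem_dt_iff.2 ⟨insert ↑m T, ?_, ⟨y, by simp [hy], hy0⟩, fun z hz => ?_⟩)
    · rw [Finset.coe_insert, Set.insert_subset_iff]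
      exact ⟨⟨m, hm, rfl⟩, hT⟩
    · have e : z = (d : F) * (x * z) + z * m := by
        have := congrArg (Subtype.val) hdm
        push_cast at this
        linear_combination (-z) * this
      rw [e]
      exact D.add_mem (D.mul_mem d.2 (hv z fun t ht => hz t (by simp [show t ∈ T from ht])))
        (hz _ (by simp))
  · by_cases hx0 : x = 0
    · obtain ⟨y, hy, hy0⟩ := Submodule.exists_mem_ne_zero_of_ne_bot h0
      refine ⟨{(y : F)}, ?_, ⟨y, by simp, by simpa using hy0⟩, fun z _ => ?_⟩
      · simpa using mem_iset_iff.2 ⟨y.2, hy⟩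
      · rw [hx0, zero_mul]
        exact D.zero_mem
    · refine ⟨{x}, by simpa using hx, ⟨x, by simp, hx0⟩, fun z hz => ?_⟩
      rw [mul_comm]
      exact hz x (by simp)

theorem ne_bot_of_isTMax {D : Subring F} {p : Ideal ↥D} (hp : IsTMax D p) :
    p ≠ ⊥ := by
  rintro rfl
  have h0 : (0 : F) ∈ iset D ↑(⊥ : Ideal ↥D) := ⟨0, by simp, rfl⟩
  rw [← hp.2.1] at h0
  obtain ⟨T, hT, ⟨y, hy, hy0⟩, -⟩ := h0
  obtain ⟨_, hyb⟩ := mem_iset_iff.1 (hT hy)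
  exact hy0 (congrArg Subtype.val ((Submodule.mem_bot _).1 hyb))

theorem PLocPrincipal.exists_gen {D : Subring F} {p : Ideal ↥D} (hp : p.IsPrime)
    (h : PLocPrincipal D p) :
    ∃ g ∈ p, ∀ x ∈ p, ∃ s : ↥D, s ∉ p ∧ ∃ d : ↥D, s * x = d * g := by
  obtain ⟨g, hg⟩ := h
  have h1 : (1 : ↥D) ∉ p := fun h => hp.ne_top ((Ideal.eq_top_iff_one p).2 h)
  have hgm : g ∈ plocIdl D p := by
    rw [hg]
    exact ⟨1, ⟨1, 1, h1, by simp⟩, by simp⟩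
  obtain ⟨y, hy, s, hs, hsg⟩ := hgm
  refine ⟨y, hy, fun x hx => ?_⟩
  have hxm : (x : F) ∈ plocIdl D p := ⟨x, hx, 1, h1, by simp⟩
  rw [hg] at hxm
  obtain ⟨d, ⟨c, t, ht, htd⟩, hxd⟩ := hxm
  refine ⟨s * t, fun h => (hp.mem_or_mem h).elim hs ht, c, Subtype.ext ?_⟩
  push_cast
  rw [← hsg, ← htd, hxd]
  ring

end TClosure

section Interpolation

variable {F L : Type} [Field F] [Field L]

theorem mem_liftsRing_of_eval_mem (S : Subring L) (f : Polynomial L) (v : ℕ → L)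
    (hv : ∀ i, v i ∈ S) (hinv : ∀ i j, i ≠ j → (v i - v j)⁻¹ ∈ S)
    (hinj : Function.Injective v) (hf : ∀ i, f.eval (v i) ∈ S) :
    f ∈ Polynomial.liftsRing S.subtype := by
  have hC : ∀ x ∈ S, C x ∈ Polynomial.liftsRing S.subtype := fun x hx =>
    (Polynomial.lifts_iff_liftsRing _ _).1 (C'_mem_lifts ⟨⟨x, hx⟩, rfl⟩)
  have hX : (X : Polynomial L) ∈ Polynomial.liftsRing S.subtype :=
    (Polynomial.lifts_iff_liftsRing _ _).1 (X_mem_lifts _)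
  have hdeg : f.degree < (Finset.range (f.natDegree + 1)).card := by
    rw [Finset.card_range]
    exact lt_of_le_of_lt degree_le_natDegree (by exact_mod_cast Nat.lt_succ_self _)
  rw [Lagrange.eq_interpolate (s := Finset.range (f.natDegree + 1)) (v := v)
    hinj.injOn hdeg, Lagrange.interpolate_apply]
  refine sum_mem fun i _ => mul_mem (hC _ (hf i)) (prod_mem fun j hj => ?_)
  exact mul_mem (hC _ (hinv i j (Finset.ne_of_mem_erase hj).symm)) (sub_mem hX (hC _ (hv j)))

/-- `R[1/γ]` inside the ambient field. -/
def invertElt (R : Subring L) (γ : L) (hγ : γ ∈ R) : Subring L where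
  carrier := {x | ∃ N : ℕ, γ ^ N * x ∈ R}
  one_mem' := ⟨0, by simp⟩
  zero_mem' := ⟨0, by simp⟩
  mul_mem' := by
    rintro x y ⟨m, hm⟩ ⟨n, hn⟩
    refine ⟨m + n, ?_⟩
    rw [pow_add, mul_mul_mul_comm]
    exact R.mul_mem hm hn
  add_mem' := by
    rintro x y ⟨m, hm⟩ ⟨n, hn⟩
    refine ⟨m + n, ?_⟩
    have e : γ ^ (m + n) * (x + y) = γ ^ n * (γ ^ m * x) + γ ^ m * (γ ^ n * y) := by ring
    rw [e]
    exact R.add_mem (R.mul_mem (R.pow_mem hγ n) hm) (R.mul_mem (R.pow_mem hγ m) hn)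
  neg_mem' := by
    rintro x ⟨m, hm⟩
    refine ⟨m, ?_⟩
    rw [mul_neg]
    exact R.neg_mem hm

theorem exists_sub_eq_pow_mul (φ : F →+* L) (D : Subring F) (R : Subring L) (g : F) (hg : g ∈ D)
    (H : ∀ b ∈ R, ∃ d ∈ D, ∃ b' ∈ R, b - φ d = φ g * b') (n : ℕ) (b : L) (hb : b ∈ R) :
    ∃ d ∈ D, ∃ b' ∈ R, b - φ d = φ g ^ n * b' := by
  induction n with
  | zero => exact ⟨0, D.zero_mem, b, hb, by simp⟩
  | succ n ih =>
    obtain ⟨d, hd, c, hc, e⟩ := ih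
    obtain ⟨d', hd', c', hc', e'⟩ := H c hc
    refine ⟨d + g ^ n * d', D.add_mem hd (D.mul_mem (D.pow_mem hg n) hd'), c', hc', ?_⟩
    rw [map_add, map_mul, map_pow]
    linear_combination e + φ g ^ n * e'

/-- If `D` is `g`-adically dense in `R` and `g` lies in the Jacobson radical of `R`, then a
polynomial mapping `D` into `R` maps `R` into `R`. -/
theorem eval_mem_of_dense (φ : F →+* L) (D : Subring F) (R : Subring L)
    (hφ : ∀ d ∈ D, φ d ∈ R) (g : F) (hg : g ∈ D) (hg0 : g ≠ 0)
    (hunit : ∀ k : ℕ, 0 < k → φ g ^ k ≠ 1 ∧ (1 - φ g ^ k)⁻¹ ∈ R)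
    (H : ∀ b ∈ R, ∃ d ∈ D, ∃ b' ∈ R, b - φ d = φ g * b')
    (f : Polynomial L) (hf : ∀ d ∈ D, f.eval (φ d) ∈ R) (b : L) (hb : b ∈ R) :
    f.eval b ∈ R := by
  have hγ0 : φ g ≠ 0 := by simpa using hg0
  have hle : ∀ x ∈ R, x ∈ invertElt R (φ g) (hφ g hg) := fun x hx => ⟨0, by simpa using hx⟩
  have hdiff : ∀ i j : ℕ, i < j → φ g ^ i - φ g ^ j ≠ 0 ∧
      (φ g ^ i - φ g ^ j)⁻¹ ∈ invertElt R (φ g) (hφ g hg) := by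
    intro i j hij
    obtain ⟨k, rfl⟩ := Nat.exists_eq_add_of_lt hij
    obtain ⟨h1, h2⟩ := hunit (k + 1) k.succ_pos
    have h3 : (1 : L) - φ g ^ (k + 1) ≠ 0 := sub_ne_zero.2 h1.symm
    have e : φ g ^ i - φ g ^ (i + k + 1) = φ g ^ i * (1 - φ g ^ (k + 1)) := by ring
    rw [e]
    refine ⟨mul_ne_zero (pow_ne_zero _ hγ0) h3, i, ?_⟩
    rw [mul_inv, mul_inv_cancel_left₀ (pow_ne_zero _ hγ0)]
    exact h2
  have hl := mem_liftsRing_of_eval_mem (invertElt R (φ g) (hφ g hg)) f (fun i => φ g ^ i)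
    (fun i => hle _ (R.pow_mem (hφ g hg) i))
    (fun i j hij => by
      rcases lt_or_gt_of_ne hij with h | h
      · exact (hdiff i j h).2
      · rw [← neg_sub, inv_neg]
        exact neg_mem (hdiff j i h).2)
    (fun i j hij => by
      by_contra hne
      rcases lt_or_gt_of_ne hne with h | h
      · exact (hdiff i j h).1 (sub_eq_zero.2 hij)
      · exact (hdiff j i h).1 (sub_eq_zero.2 hij.symm))
    (fun i => hle _ (by rw [← map_pow]; exact hf _ (D.pow_mem hg i)))
  rw [← lifts_iff_liftsRing, lifts_iff_coeff_lifts] at hl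
  have hN : ∀ n, ∃ N : ℕ, φ g ^ N * f.coeff n ∈ R := by
    intro n
    obtain ⟨⟨x, hx⟩, e⟩ := hl n
    obtain rfl : x = f.coeff n := e
    exact hx
  choose N hN using hN
  obtain ⟨M, hM⟩ : ∃ M, ∀ n ∈ f.support, N n ≤ M :=
    ⟨f.support.sup N, fun n hn => Finset.le_sup hn⟩
  have hfl : C (φ g ^ M) * f ∈ lifts R.subtype := by
    rw [lifts_iff_coeff_lifts]
    intro n
    rw [coeff_C_mul]
    by_cases hn : n ∈ f.support
    · obtain ⟨k, hk⟩ := Nat.exists_eq_add_of_le (hM n hn)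
      refine ⟨⟨_, R.mul_mem (R.pow_mem (hφ g hg) k) (hN n)⟩, ?_⟩
      simp only [Subring.subtype_apply]
      rw [hk]
      ring
    · rw [notMem_support_iff.1 hn]
      exact ⟨0, by simp⟩
  obtain ⟨P, hP⟩ := (mem_lifts _).1 hfl
  obtain ⟨d, hd, b', hb', e⟩ := exists_sub_eq_pow_mul φ D R g hg H M b hb
  obtain ⟨c, hc⟩ := P.sub_dvd_eval_sub ⟨b, hb⟩ ⟨φ d, hφ d hd⟩
  have hev : ∀ x : ↥R, φ g ^ M * f.eval (x : L) = (P.eval x : ↥R) := by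
    intro x
    have := congrArg (eval (x : L)) hP
    rw [eval_mul, eval_C] at this
    rw [← this, eval_map]
    exact (eval₂_at_apply R.subtype x)
  have hc' := congrArg (Subtype.val) hc
  push_cast at hc'
  rw [← hev, ← hev, e] at hc'
  have hfin : f.eval b = f.eval (φ d) + b' * c := by
    apply mul_left_cancel₀ (pow_ne_zero M hγ0)
    linear_combination hc'
  rw [hfin]
  exact R.add_mem (hf d hd) (R.mul_mem hb' c.2)

end Interpolation

section Local

variable {F L : Type} [Field F] [Field L]

theorem le_primeLoc (A : Subring L) (q : Ideal ↥A) (hq : q.IsPrime) : A ≤ primeLoc A q hq :=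
  fun a ha => ⟨⟨a, ha⟩, 1, fun h => hq.ne_top ((Ideal.eq_top_iff_one q).2 h), by simp⟩

theorem inv_mem_primeLoc {A : Subring L} {q : Ideal ↥A} (hq : q.IsPrime) {s : ↥A} (hs : s ∉ q) :
    (s : L)⁻¹ ∈ primeLoc A q hq := by
  have hs0 : (s : L) ≠ 0 := by
    intro h
    exact hs ((Subtype.ext h : s = 0) ▸ q.zero_mem)
  exact ⟨1, s, hs, by simp [hs0]⟩

/-- Over a prime with infinite residue field, integer-valued polynomials are trivial. -/
theorem eval_mem_of_infinite (φ : F →+* L) (D : Subring F) (A : Subring L)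
    (hA : ExtMem D φ A) (q : Ideal ↥A) (hq : q.IsPrime)
    (hinf : Infinite (↥D ⧸ q.comap (extHom D φ A hA)))
    (f : Polynomial L) (hf : f ∈ IntOn (φ '' ↑D) ↑A) (a : L) (ha : a ∈ A) :
    f.eval a ∈ primeLoc A q hq := by
  set p := q.comap (extHom D φ A hA)
  let e : ℕ ↪ ↥D ⧸ p := Infinite.natEmbedding _
  choose d hd using fun n => Ideal.Quotient.mk_surjective (e n)
  have hle := le_primeLoc A q hq
  have hsub : ∀ i j, i ≠ j → extHom D φ A hA (d i - d j) ∉ q := by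
    intro i j hij h
    refine hij (e.injective ?_)
    rw [← hd, ← hd]
    exact Ideal.Quotient.eq.2 h
  have hval : ∀ i j, (extHom D φ A hA (d i - d j) : L) = φ (d i) - φ (d j) := by
    intro i j
    rw [← map_sub]
    rfl
  have hl := mem_liftsRing_of_eval_mem (primeLoc A q hq) f (fun n => φ (d n))
    (fun n => hle (hA (d n)))
    (fun i j hij => by
      have := inv_mem_primeLoc hq (hsub i j hij)
      rwa [hval] at this)
    (fun i j hij => by
      by_contra hne
      refine hsub i j hne ?_
      have : extHom D φ A hA (d i - d j) = 0 := by
        apply Subtype.ext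
        rw [hval]
        exact sub_eq_zero.2 hij
      rw [this]
      exact q.zero_mem)
    (fun n => hle (hf _ ⟨d n, (d n).2, rfl⟩))
  rw [← lifts_iff_liftsRing, mem_lifts] at hl
  obtain ⟨P, rfl⟩ := hl
  have := eval₂_at_apply (p := P) (primeLoc A q hq).subtype ⟨a, hle ha⟩
  rw [eval_map]
  exact this ▸ Subtype.prop _

/-- Over a prime with finite residue field, `pD_p` principal, `pA_q = qA_q` and `κ(p) = κ(q)`,
polynomials in `Int(D,A)` map `A` into `A_q`. -/
theorem eval_mem_of_finite (φ : F →+* L) (D : Subring F) (A : Subring L)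
    (hA : ExtMem D φ A) (q : Ideal ↥A) (hq : q.IsPrime) (p : Ideal ↥D)
    (hpq : q.comap (extHom D φ A hA) = p) (hpm : p.IsMaximal) (hp0 : p ≠ ⊥)
    (hprin : PLocPrincipal D p)
    (hspan : Submodule.span ↥(primeLoc A q hq) (φ '' iset D ↑p) =
      Submodule.span ↥(primeLoc A q hq) (iset A ↑q))
    (hres : ∀ x ∈ plocSet A q, ∃ y ∈ plocSet D p, x - φ y ∈ plocIdl A q)
    (f : Polynomial L) (hf : f ∈ IntOn (φ '' ↑D) ↑A) (a : L) (ha : a ∈ A) :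
    f.eval a ∈ primeLoc A q hq := by
  have hle := le_primeLoc A q hq
  have hmem : ∀ d : ↥D, extHom D φ A hA d ∈ q ↔ d ∈ p := fun d => by rw [← hpq]; rfl
  obtain ⟨g, hgp, hgen⟩ := hprin.exists_gen hpm.isPrime
  have hg0 : (g : F) ≠ 0 := by
    obtain ⟨x, hx, hx0⟩ := Submodule.exists_mem_ne_zero_of_ne_bot hp0
    obtain ⟨s, hs, d, e⟩ := hgen x hx
    intro h
    have hg : g = 0 := Subtype.ext h
    rw [hg, mul_zero] at e
    rcases mul_eq_zero.1 e with h | h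
    · exact hs (h ▸ p.zero_mem)
    · exact hx0 h
  have hinv : ∀ s : ↥D, s ∉ p → φ s ≠ 0 ∧ (φ s)⁻¹ ∈ primeLoc A q hq := by
    intro s hs
    refine ⟨?_, inv_mem_primeLoc hq (fun h => hs ((hmem s).1 h))⟩
    intro h
    have : s = 0 := Subtype.ext (by simpa using h)
    exact hs (this ▸ p.zero_mem)
  have hspan_le : ∀ z ∈ Submodule.span ↥(primeLoc A q hq) (iset A ↑q),
      ∃ r ∈ primeLoc A q hq, z = φ g * r := by
    intro z hz
    rw [← hspan] at hz
    induction hz using Submodule.span_induction with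
    | mem x hx =>
      obtain ⟨y, ⟨x, hx, rfl⟩, rfl⟩ := hx
      obtain ⟨s, hs, d, e⟩ := hgen x hx
      obtain ⟨hs0, hsi⟩ := hinv s hs
      refine ⟨(φ s)⁻¹ * φ d, mul_mem hsi (hle (hA d)), ?_⟩
      have e' := congrArg (fun t : ↥D => φ t) e
      simp only [Subring.coe_mul, map_mul] at e'
      field_simp
      linear_combination e'
    | zero => exact ⟨0, zero_mem _, by simp⟩
    | add x y _ _ hx hy =>
      obtain ⟨r, hr, rfl⟩ := hx
      obtain ⟨r', hr', rfl⟩ := hy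
      exact ⟨r + r', add_mem hr hr', by ring⟩
    | smul c x _ hx =>
      obtain ⟨r, hr, rfl⟩ := hx
      refine ⟨c * r, mul_mem c.2 hr, ?_⟩
      rw [Subring.smul_def, smul_eq_mul]
      ring
  have hφp : ∀ m ∈ p, φ (m : ↥D) ∈ Submodule.span ↥(primeLoc A q hq) (iset A ↑q) := by
    intro m hm
    rw [← hspan]
    exact Submodule.subset_span ⟨m, ⟨m, hm, rfl⟩, rfl⟩
  refine eval_mem_of_dense φ D (primeLoc A q hq) (fun d hd => hle (hA ⟨d, hd⟩)) g g.2 hg0 ?_ ?_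
    f (fun d hd => hle (hf _ ⟨d, hd, rfl⟩)) a (hle ha)
  · intro k hk
    have hgk : (1 : ↥D) - g ^ k ∉ p := by
      intro h
      have h' := p.add_mem h (p.pow_mem_of_mem hgp k hk)
      rw [sub_add_cancel] at h'
      exact hpm.ne_top ((Ideal.eq_top_iff_one p).2 h')
    obtain ⟨h1, h2⟩ := hinv _ hgk
    push_cast at h1 h2
    rw [map_sub, map_one, map_pow] at h1 h2
    exact ⟨fun h => h1 (sub_eq_zero.2 h.symm), h2⟩
  · intro b hb
    obtain ⟨y, ⟨c, s, hs, hy⟩, z, hz, t, ht, hzt⟩ := hres b hb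
    obtain ⟨s', m, hm, e⟩ := hpm.exists_inv hs
    have hs0 : (s : F) ≠ 0 := fun h => (hinv s hs).1 (by rw [h, map_zero])
    have e' := congrArg Subtype.val e
    push_cast at e'
    refine ⟨c * s', D.mul_mem c.2 s'.2, ?_⟩
    suffices h : b - φ (c * s') ∈ Submodule.span ↥(primeLoc A q hq) (iset A ↑q) by
      obtain ⟨r, hr, h⟩ := hspan_le _ h
      exact ⟨r, hr, h⟩
    have hsplit : b - φ (c * s') = (t : L)⁻¹ * z + ((φ s)⁻¹ * φ c) * φ m := by
      have ht0 : (t : L) ≠ 0 := fun h => ht ((Subtype.ext h : t = 0) ▸ q.zero_mem)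
      have h1 : b - φ y = (t : L)⁻¹ * z := by
        rw [← hzt, inv_mul_cancel_left₀ ht0]
      have h2 : y - c * s' = (s : F)⁻¹ * c * m := by
        field_simp
        linear_combination hy - (c : F) * e'
      have h3 := congrArg φ h2
      rw [map_sub, map_mul, map_mul, map_mul, map_inv₀] at h3
      rw [map_mul]
      linear_combination h1 + h3
    rw [hsplit]
    refine add_mem ?_ ?_
    · exact Submodule.smul_mem _ (⟨_, inv_mem_primeLoc hq ht⟩ : ↥(primeLoc A q hq))
        (Submodule.subset_span ⟨z, hz, rfl⟩)
    · exact Submodule.smul_mem _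
        (⟨_, mul_mem (hinv s hs).2 (hle (hA c))⟩ : ↥(primeLoc A q hq)) (hφp m hm)

/-- The polynomial `g⁻¹ ∏ (X - d)`, over representatives `d` of the residue classes modulo `p`,
lies in `Int(D_p) = Int(D)_p`; evaluating it on `A` after clearing denominators. -/
theorem exists_prod_eq (φ : F →+* L) (D : Subring F) (A : Subring L)
    (hA : ExtMem D φ A) (p : Ideal ↥D) (hpm : p.IsMaximal) [Fintype (↥D ⧸ p)]
    (hint : IntR (plocSet D p) = plocPoly D p (IntR (↑D : Set F)))
    (g : ↥D) (hg0 : g ≠ 0)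
    (hgen : ∀ x ∈ p, ∃ s : ↥D, s ∉ p ∧ ∃ d : ↥D, s * x = d * g)
    (hW : WPolyComplete D φ A) (r : ↥D ⧸ p → ↥D) (hr : ∀ c, Ideal.Quotient.mk p (r c) = c) :
    ∃ s : ↥D, s ∉ p ∧ ∀ a : ↥A, ∃ b : ↥A,
      extHom D φ A hA s * ∏ c, (a - extHom D φ A hA (r c)) = extHom D φ A hA g * b := by
  have hg0' : (g : F) ≠ 0 := by simpa using hg0
  have hmem : C (g : F)⁻¹ * ∏ c, (X - C (r c : F)) ∈ IntR (plocSet D p) := by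
    intro x hx
    rw [eval_mul, eval_C, eval_prod]
    simp only [eval_sub, eval_X, eval_C]
    have hprod : ∀ c, x - (r c : F) ∈ primeLoc D p hpm.isPrime := fun c =>
      sub_mem hx (le_primeLoc D p hpm.isPrime (r c).2)
    obtain ⟨a, s, hs, hxa⟩ := hx
    obtain ⟨s', m, hm, e⟩ := hpm.exists_inv hs
    set c₀ := Ideal.Quotient.mk p (a * s')
    have hd : r c₀ - a * s' ∈ p := Ideal.Quotient.eq.1 (hr c₀)
    have hsd : a - s * r c₀ ∈ p := by
      have : a - s * r c₀ = a * m - s * (r c₀ - a * s') := by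
        linear_combination (-a) * e
      rw [this]
      exact sub_mem (p.mul_mem_left _ hm) (p.mul_mem_left _ hd)
    obtain ⟨t, ht, d, htd⟩ := hgen _ hsd
    have hfac : (g : F)⁻¹ * (x - r c₀) ∈ primeLoc D p hpm.isPrime := by
      refine ⟨d, s * t, fun h => (hpm.isPrime.mem_or_mem h).elim hs ht, ?_⟩
      have htd' := congrArg Subtype.val htd
      push_cast at htd' ⊢
      field_simp
      linear_combination (t : F) * hxa + htd'
    classical
    rw [← Finset.mul_prod_erase _ _ (Finset.mem_univ c₀), ← mul_assoc]
    exact mul_mem hfac (prod_mem fun c _ => hprod c)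
  rw [hint] at hmem
  obtain ⟨h, hh, s, hs, e⟩ := hmem
  refine ⟨s, hs, fun a => ?_⟩
  have hb := hW ⟨h, hh, rfl⟩ a a.2
  subst e
  refine ⟨⟨_, hb⟩, Subtype.ext ?_⟩
  have hφg : φ g ≠ 0 := by simpa using hg0'
  simp only [Polynomial.map_mul, Polynomial.map_prod, Polynomial.map_sub, map_C, map_X, eval_mul,
    eval_prod, eval_sub, eval_X, eval_C, Subring.coe_mul, map_inv₀]
  have hcoe : ∀ d : ↥D, (extHom D φ A hA d : L) = φ d := fun _ => rfl
  push_cast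
  simp only [hcoe]
  field_simp

theorem span_eq_and_surjective_of_wPolyComplete (φ : F →+* L) (D : Subring F) (A : Subring L)
    (hA : ExtMem D φ A) (p : Ideal ↥D) (hpm : p.IsMaximal) (hp0 : p ≠ ⊥) [Finite (↥D ⧸ p)]
    (hprin : PLocPrincipal D p)
    (hint : IntR (plocSet D p) = plocPoly D p (IntR (↑D : Set F)))
    (hW : WPolyComplete D φ A)
    (q : Ideal ↥A) (hq : q.IsPrime) (hpq : q.comap (extHom D φ A hA) = p) :
    Submodule.span ↥(primeLoc A q hq) (φ '' iset D ↑p) =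
        Submodule.span ↥(primeLoc A q hq) (iset A ↑q) ∧
      ∀ x ∈ plocSet A q, ∃ y ∈ plocSet D p, x - φ y ∈ plocIdl A q := by
  have hmem : ∀ d : ↥D, extHom D φ A hA d ∈ q ↔ d ∈ p := fun d => by rw [← hpq]; rfl
  obtain ⟨g, hgp, hgen⟩ := hprin.exists_gen hpm.isPrime
  have hg0 : g ≠ 0 := by
    obtain ⟨x, hx, hx0⟩ := Submodule.exists_mem_ne_zero_of_ne_bot hp0
    obtain ⟨s, hs, d, e⟩ := hgen x hx
    rintro rfl
    rw [mul_zero] at e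
    rcases mul_eq_zero.1 e with h | h
    · exact hs (h ▸ p.zero_mem)
    · exact hx0 h
  have := Fintype.ofFinite (↥D ⧸ p)
  choose r hr using Ideal.Quotient.mk_surjective (I := p)
  obtain ⟨s, hs, hsb⟩ := exists_prod_eq φ D A hA p hpm hint g hg0 hgen hW r hr
  have hres : ∀ a : ↥A, ∃ d : ↥D, a - extHom D φ A hA d ∈ q := by
    intro a
    obtain ⟨b, hb⟩ := hsb a
    have h : extHom D φ A hA s * ∏ c, (a - extHom D φ A hA (r c)) ∈ q := by
      rw [hb]
      exact q.mul_mem_right _ ((hmem g).2 hgp)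
    have h := (hq.mem_or_mem h).resolve_left fun h => hs ((hmem s).1 h)
    obtain ⟨c, -, hc⟩ := hq.prod_mem_iff.1 h
    exact ⟨_, hc⟩
  have hdiv : ∀ a ∈ q, ∃ u : ↥A, u ∉ q ∧ ∃ b : ↥A, u * a = extHom D φ A hA g * b := by
    intro a ha
    obtain ⟨b, hb⟩ := hsb a
    have hr0 : r 0 ∈ p := Ideal.Quotient.eq_zero_iff_mem.1 (hr 0)
    obtain ⟨t, ht, d, htd⟩ := hgen _ hr0
    have htd' := congrArg (extHom D φ A hA) htd
    rw [map_mul, map_mul] at htd'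
    classical
    rw [← Finset.mul_prod_erase _ _ (Finset.mem_univ 0)] at hb
    set w := ∏ c ∈ Finset.univ.erase (0 : ↥D ⧸ p), (a - extHom D φ A hA (r c)) with hw
    have hwq : w ∉ q := by
      intro h
      obtain ⟨c, hc, hcq⟩ := hq.prod_mem_iff.1 h
      have h' := (hmem _).1 ((q.sub_mem_iff_right ha).1 hcq)
      refine Finset.ne_of_mem_erase hc ?_
      rw [← hr c]
      exact Ideal.Quotient.eq_zero_iff_mem.2 h'
    refine ⟨extHom D φ A hA s * w * extHom D φ A hA t, fun h => ?_,
      extHom D φ A hA t * b + extHom D φ A hA s * w * extHom D φ A hA d, ?_⟩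
    · rcases hq.mem_or_mem h with h | h
      · rcases hq.mem_or_mem h with h | h
        · exact hs ((hmem s).1 h)
        · exact hwq h
      · exact ht ((hmem t).1 h)
    · linear_combination extHom D φ A hA t * hb + extHom D φ A hA s * w * htd'
  refine ⟨le_antisymm (Submodule.span_mono ?_) (Submodule.span_le.2 ?_), ?_⟩
  · rintro _ ⟨_, ⟨x, hx, rfl⟩, rfl⟩
    exact ⟨extHom D φ A hA x, (hmem x).2 hx, rfl⟩
  · rintro _ ⟨a, ha, rfl⟩
    obtain ⟨u, hu, b, e⟩ := hdiv a ha
    have hu0 : (u : L) ≠ 0 := fun h => hu ((Subtype.ext h : u = 0) ▸ q.zero_mem)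
    have e' : (u : L) * a = φ g * b := congrArg Subtype.val e
    have ha' : (a : L) = ((u : L)⁻¹ * b) * φ g := by
      field_simp
      linear_combination e'
    rw [ha']
    exact Submodule.smul_mem _ (⟨_, mul_mem (inv_mem_primeLoc hq hu)
      (le_primeLoc A q hq b.2)⟩ : ↥(primeLoc A q hq)) (Submodule.subset_span ⟨g, ⟨g, hgp, rfl⟩, rfl⟩)
  · rintro x ⟨a, t, ht, hx⟩
    obtain ⟨d, hd⟩ := hres a
    obtain ⟨e, he⟩ := hres t
    have hep : e ∉ p := by
      intro h
      refine ht ?_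
      have := q.add_mem he ((hmem e).2 h)
      rwa [sub_add_cancel] at this
    have hφe : φ e ≠ 0 := by
      intro h
      have : e = 0 := Subtype.ext (by simpa using h)
      exact hep (this ▸ p.zero_mem)
    have he0 : (e : F) ≠ 0 := fun h => hφe (by rw [h, map_zero])
    refine ⟨d / e, ⟨d, e, hep, mul_div_cancel₀ _ he0⟩,
      extHom D φ A hA e * a - t * extHom D φ A hA d, ?_, t * extHom D φ A hA e, ?_, ?_⟩
    · have : extHom D φ A hA e * a - t * extHom D φ A hA d =
          extHom D φ A hA e * (a - extHom D φ A hA d) -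
            (t - extHom D φ A hA e) * extHom D φ A hA d := by ring
      rw [this]
      exact sub_mem (q.mul_mem_left _ hd) (q.mul_mem_right _ he)
    · exact fun h => (hq.mem_or_mem h).elim ht fun h => hep ((hmem e).1 h)
    · have hcoe : ∀ d : ↥D, (extHom D φ A hA d : L) = φ d := fun _ => rfl
      push_cast
      rw [hcoe, hcoe, map_div₀, ← hx]
      field_simp

end Local

theorem infinite_quotient_bot {F : Type} [Field F] (D : Subring F) (hqfD : IsQuotField D)
    (hne : (↑D : Set F) ≠ Set.univ) : Infinite (↥D ⧸ (⊥ : Ideal ↥D)) := by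
  by_contra h
  rw [not_infinite_iff_finite] at h
  have : Finite ↥D := Finite.of_injective (Ideal.Quotient.mk (⊥ : Ideal ↥D))
    (RingHom.injective_iff_ker_eq_bot _ |>.2 Ideal.mk_ker)
  have hf := Finite.isField_of_domain ↥D
  refine hne (Set.eq_univ_of_forall fun x => ?_)
  obtain ⟨a, b, hb, e⟩ := hqfD x
  obtain ⟨c, hc⟩ := hf.mul_inv_cancel hb
  have hc' := congrArg Subtype.val hc
  push_cast at hc'
  have : x = (c : F) * a := by linear_combination (-x) * hc' + (c : F) * e
  rw [this]
  exact D.mul_mem c.2 a.2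

/-- The conductor `(A :_A x)` as an ideal. -/
def condIdeal {L : Type} [Field L] (A : Subring L) (x : L) : Ideal ↥A where
  carrier := {c | (c : L) * x ∈ A}
  zero_mem' := by simp
  add_mem' := fun {a b} ha hb => by
    change ((a + b : ↥A) : L) * x ∈ A
    rw [Subring.coe_add, add_mul]
    exact A.add_mem ha hb
  smul_mem' := fun c a ha => by
    change ((c * a : ↥A) : L) * x ∈ A
    rw [Subring.coe_mul, mul_assoc]
    exact A.mul_mem c.2 ha

/-- `A` is the intersection of its localizations at the maximal elements among the ideals `I`
with `1 ∉ I_t`. -/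
theorem mem_of_forall_mem_primeLoc {L : Type} [Field L] (A : Subring L) (x : L)
    (h : ∀ q : Ideal ↥A, ∀ hq : q.IsPrime, (1 : L) ∉ dt ↑A (iset A ↑q) →
      x ∈ primeLoc A q hq) : x ∈ A := by
  by_contra hx
  have hI : (1 : L) ∉ dt ↑A (iset A ↑(condIdeal A x)) := by
    intro h1
    obtain ⟨T, hT, -, hd⟩ := one_mem_dt_iff.1 h1
    refine hx (hd x fun t ht => ?_)
    obtain ⟨_, hc⟩ := mem_iset_iff.1 (hT ht)
    rw [mul_comm]
    exact hc
  obtain ⟨q, hle, hq⟩ := exists_maximal_ge _ hI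
  obtain ⟨a, s, hs, e⟩ := h q (isPrime_of_maximal hq) hq.1
  refine hs (hle ?_)
  change (s : L) * x ∈ A
  rw [e]
  exact a.2

end IVP

/-- Suppose every t-maximal ideal `p` of `D` with finite residue
field has `pD_p` principal and `Int(D_p) = Int(D)_p`.  Then for a t-linked extension
`A` of `D` the following are equivalent: (1) `A` is polynomially complete over `D`;
(2) `A` is weakly polynomially complete over `D`; (3) for every t-maximal ideal `p`
of `D` with finite residue field and every prime `q` of `A` lying over `p`, one has
`pA_q = qA_q` and the residue field embedding `κ(p) → κ(q)` is an isomorphism (i.e.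
the map `D_p → A_q/qA_q` is surjective). -/
theorem stmt_19 (F : Type) [Field F] (D : Subring F)
    (hqfD : IsQuotField D) (hne : (↑D : Set F) ≠ Set.univ)
    (hyp : ∀ p : Ideal ↥D, IsTMax D p → Finite (↥D ⧸ p) →
      PLocPrincipal D p ∧ IntR (plocSet D p) = plocPoly D p (IntR (↑D : Set F)))
    (L : Type) [Field L] (φ : F →+* L) (A : Subring L) (hA : ExtMem D φ A)
    (hqfA : IsQuotField A) (hTL : TLinkedExt D φ A hA) :
    (PolyComplete D φ A ↔ WPolyComplete D φ A) ∧
      (PolyComplete D φ A ↔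
        ∀ p : Ideal ↥D, IsTMax D p → Finite (↥D ⧸ p) →
          ∀ q : Ideal ↥A, ∀ hq : q.IsPrime, q.comap (extHom D φ A hA) = p →
            Submodule.span ↥(primeLoc A q hq) (φ '' iset D ↑p) =
                Submodule.span ↥(primeLoc A q hq) (iset A ↑q) ∧
              ∀ x ∈ plocSet A q, ∃ y ∈ plocSet D p, x - φ y ∈ plocIdl A q) := by
  have h12 : PolyComplete D φ A → WPolyComplete D φ A := by
    rintro h _ ⟨f, hf, rfl⟩
    rw [← h]
    rintro _ ⟨x, hx, rfl⟩
    rw [eval_map_apply]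
    exact hA ⟨_, hf x hx⟩
  have h23 : WPolyComplete D φ A →
      ∀ p : Ideal ↥D, IsTMax D p → Finite (↥D ⧸ p) →
          ∀ q : Ideal ↥A, ∀ hq : q.IsPrime, q.comap (extHom D φ A hA) = p →
            Submodule.span ↥(primeLoc A q hq) (φ '' iset D ↑p) =
                Submodule.span ↥(primeLoc A q hq) (iset A ↑q) ∧
              ∀ x ∈ plocSet A q, ∃ y ∈ plocSet D p, x - φ y ∈ plocIdl A q := by
    intro hW p hp hfin q hq hpq
    obtain ⟨hprin, hint⟩ := hyp p hp hfin
    have hpp : p.IsPrime := hpq ▸ hq.comap _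
    exact span_eq_and_surjective_of_wPolyComplete φ D A hA p
      (Ideal.Quotient.maximal_of_isField p (Finite.isField_of_domain _))
      (ne_bot_of_isTMax hp) hprin hint hW q hq hpq
  have h31 : (∀ p : Ideal ↥D, IsTMax D p → Finite (↥D ⧸ p) →
          ∀ q : Ideal ↥A, ∀ hq : q.IsPrime, q.comap (extHom D φ A hA) = p →
            Submodule.span ↥(primeLoc A q hq) (φ '' iset D ↑p) =
                Submodule.span ↥(primeLoc A q hq) (iset A ↑q) ∧
              ∀ x ∈ plocSet A q, ∃ y ∈ plocSet D p, x - φ y ∈ plocIdl A q) →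
      PolyComplete D φ A := by
    intro h3
    refine Set.Subset.antisymm (fun f hf a ha => ?_) (fun f hf => ?_)
    · refine mem_of_forall_mem_primeLoc A _ fun q hq h1 => ?_
      by_cases hfin : Finite (↥D ⧸ q.comap (extHom D φ A hA))
      · have hp0 : q.comap (extHom D φ A hA) ≠ ⊥ := by
          intro h
          rw [h] at hfin
          exact not_finite_iff_infinite.2 (infinite_quotient_bot D hqfD hne) hfin
        have hpp : (q.comap (extHom D φ A hA)).IsPrime := hq.comap _
        have hpm : (q.comap (extHom D φ A hA)).IsMaximal :=
          Ideal.Quotient.maximal_of_isField _ (Finite.isField_of_domain _)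
        have hp1 : (1 : F) ∉ dt ↑D (iset D ↑(q.comap (extHom D φ A hA))) := by
          intro h
          have h' := hTL _ hp0 (dt_eq_of_one_mem h)
          refine h1 (dt_mono (iset_mono (Ideal.map_comap_le (f := extHom D φ A hA))) ?_)
          rw [h']
          exact A.one_mem
        have hT := isTMax_of_isMaximal hpm hp0 hp1
        obtain ⟨hspan, hres⟩ := h3 _ hT hfin q hq rfl
        exact eval_mem_of_finite φ D A hA q hq _ rfl hpm hp0 (hyp _ hT hfin).1 hspan hres
          f hf a ha
      · exact eval_mem_of_infinite φ D A hA q hq (not_finite_iff_infinite.1 hfin) f hf a ha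
    · rintro _ ⟨x, hx, rfl⟩
      exact hf _ (hA ⟨x, hx⟩)
  exact ⟨⟨h12, fun h => h31 (h23 h)⟩, ⟨fun h => h23 (h12 h), h31⟩⟩
end
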